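/- Let τ1 : Ω × Ω → {C,D} be a deterministic memory-two strategy, set τ2(s1,s2) := τ1(π(s1), π(s2)) (so τ2 is the same strategy as τ1 with the roles of the players swapped), and suppose the pair (τ1, τ2) forms a symmetric mutual reinforcement learning equilibrium: there exist Q1, Q2 : {C,D} × Ω × Ω → ℝ such that Q1 satisfies the player-1 memory-two Bellman optimality equation against τ2 with τ1 strictly greedy for Q1, and Q2 satisfies the player-2 memory-two Bellman optimality equation against τ1 with τ2 strictly greedy for Q2. Then for every s1 ∈ {(C,C),(D,D)}, one has τ1(s1,(C,D)) = τ1(s1,(D,C)). -/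

import Mathlib

inductive Act where
  | C : Act
  | D : Act
deriving DecidableEq

open Act

abbrev St : Type := Act × Act

/-- Player 1's payoff in the prisoner's dilemma. -/
def r1 (R S T P : ℝ) : Act → Act → ℝ
  | C, C => R
  | C, D => S
  | D, C => T
  | D, D => P

/-- Swap the roles of the two players in a state. -/
def pi' (s : St) : St := (s.2, s.1)

/-- A strictly greedy strategy plays the same action after two histories with equal action values. -/
theorem eq_of_strictlyGreedy {Q : Act → St → St → ℝ} {τ : St → St → Act}
    (hg : ∀ s1 s2, (τ s1 s2 = C → Q C s1 s2 > Q D s1 s2) ∧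
      (τ s1 s2 = D → Q D s1 s2 > Q C s1 s2))
    {s x y : St} (hQ : ∀ σ, Q σ s x = Q σ s y) : τ s x = τ s y := by
  have hx := hg s x
  have hy := hg s y
  rw [hQ, hQ] at hx
  cases h : τ s x <;> cases h' : τ s y
  · rfl
  · exact absurd (hx.1 h) (hy.2 h').asymm
  · exact absurd (hx.2 h) (hy.1 h').asymm
  · rfl

theorem Act.eq_of_eq_imp_eq {a b e : Act} (h₁ : b = e → a = e) (h₂ : a = e → b = e) : a = b := by
  cases a <;> cases b <;> cases e <;> simp_all

/-- in a symmetric mutual reinforcement learning equilibrium formed by a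
deterministic memory-two strategy and its mirror, for `s1 ∈ {(C,C),(D,D)}` the strategy takes
the same action after second-to-last states `(C,D)` and `(D,C)`. -/
theorem stmt_3 (R S T P γ : ℝ) (hTR : T > R) (hRP : R > P) (hPS : P > S)
    (h2R : 2 * R > T + S) (hγ0 : 0 ≤ γ) (hγ1 : γ < 1)
    (τ1 : St → St → Act) (τ2 : St → St → Act)
    (hτ2 : ∀ s1 s2, τ2 s1 s2 = τ1 (pi' s1) (pi' s2))
    (Q1 Q2 : Act → St → St → ℝ)
    (hQ1 : ∀ σ s1 s2, Q1 σ s1 s2 =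
      r1 R S T P σ (τ2 s1 s2) +
        γ * max (Q1 C (σ, τ2 s1 s2) s1) (Q1 D (σ, τ2 s1 s2) s1))
    (hg1 : ∀ s1 s2, (τ1 s1 s2 = C → Q1 C s1 s2 > Q1 D s1 s2) ∧
      (τ1 s1 s2 = D → Q1 D s1 s2 > Q1 C s1 s2))
    (hQ2 : ∀ σ s1 s2, Q2 σ s1 s2 =
      r1 R S T P σ (τ1 s1 s2) +
        γ * max (Q2 C (τ1 s1 s2, σ) s1) (Q2 D (τ1 s1 s2, σ) s1))
    (hg2 : ∀ s1 s2, (τ2 s1 s2 = C → Q2 C s1 s2 > Q2 D s1 s2) ∧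
      (τ2 s1 s2 = D → Q2 D s1 s2 > Q2 C s1 s2)) :
    ∀ s1 : St, s1 = (C, C) ∨ s1 = (D, D) → τ1 s1 (C, D) = τ1 s1 (D, C) := by
  have key : ∀ s x y, τ2 s x = τ2 s y → τ1 s x = τ1 s y := fun s x y h =>
    eq_of_strictlyGreedy hg1 fun σ => by rw [hQ1 σ s x, hQ1 σ s y, h]
  intro s hs
  have hπ : pi' s = s := by rcases hs with rfl | rfl <;> rfl
  -- After the symmetric history `(s, s)` both players take the action `τ1 s s`.
  have h₁ : τ1 s (D, C) = τ1 s s → τ1 s (C, D) = τ1 s s := fun h =>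
    key s (C, D) s (by rw [hτ2, hτ2, hπ]; exact h)
  have h₂ : τ1 s (C, D) = τ1 s s → τ1 s (D, C) = τ1 s s := fun h =>
    key s (D, C) s (by rw [hτ2, hτ2, hπ]; exact h)
  exact Act.eq_of_eq_imp_eq h₁ h₂
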